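/- arXiv:1508.05513 — 2 statements merged into one kernel-verified Lean document; each statement's English description precedes it below -/
import Mathlib

section
/- For all r ∈ (0,1), S_{11/4,7/4}(1, √(1−r²)) < (2/π) E(r) < (22/(7π)) S_{11/4,7/4}(1, √(1−r²)), where E is the complete elliptic integral of the second kind and S_{11/4,7/4}(1,x) = (7/11)(1−x^{11/4})/(1−x^{7/4}). -/
open Real

/-- Complete elliptic integral of the second kind. -/
noncomputable def ellipticE (r : ℝ) : ℝ :=
  ∫ t in (0:ℝ)..(π / 2), Real.sqrt (1 - r ^ 2 * Real.sin t ^ 2)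

/-- The Stolarsky mean `S_{11/4,7/4}(1,x)`. -/
noncomputable def S117 (x : ℝ) : ℝ := 7 / 11 * (1 - x ^ ((11:ℝ) / 4)) / (1 - x ^ ((7:ℝ) / 4))

/-- The coefficients of the power series of `(1 - u) ^ a`. -/
def oneSubRpowCoeff (a : ℚ) : ℕ → ℚ
  | 0 => 1
  | n + 1 => oneSubRpowCoeff a n * ((n - a) / (n + 1))

/-- The coefficients of the power series of `2 / π * ellipticE (√u)`. -/
def ellipticCoeff : ℕ → ℚ
  | 0 => 1
  | n + 1 => ellipticCoeff n * ((n ^ 2 - 1 / 4) / (n + 1) ^ 2)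

/-- The coefficients of the power series of `2 / π * ellipticE (√u) * (1 - u) ^ (7 / 8)`. -/
def ellipticMulCoeff (n : ℕ) : ℚ :=
  ∑ p ∈ Finset.HasAntidiagonal.antidiagonal n, ellipticCoeff p.1 * oneSubRpowCoeff (7 / 8) p.2

/-- The coefficients of the power series of
`2 / π * ellipticE (√u) * (1 - (1 - u) ^ (7 / 8)) - 7 / 11 * (1 - (1 - u) ^ (11 / 8))`. -/
def defectCoeff (n : ℕ) : ℚ :=
  ellipticCoeff n - ellipticMulCoeff n + 7 / 11 * oneSubRpowCoeff (11 / 8) n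
    - if n = 0 then 7 / 11 else 0

theorem ellipticCoeff_eq_mul (n : ℕ) :
    ellipticCoeff n = oneSubRpowCoeff (1 / 2) n * oneSubRpowCoeff (-1 / 2) n := by
  induction n with
  | zero => simp [ellipticCoeff, oneSubRpowCoeff]
  | succ n ih =>
    have : (n : ℚ) + 1 ≠ 0 := by positivity
    simp only [ellipticCoeff, oneSubRpowCoeff, ih]
    field_simp
    ring

section Recurrence

open PowerSeries

theorem coeff_X_mul_derivative (F : ℚ⟦X⟧) (n : ℕ) :
    coeff n (X * d⁄dX ℚ F) = n * coeff n F := by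
  cases n with
  | zero => simp
  | succ n => rw [coeff_succ_X_mul, coeff_derivative]; push_cast; ring

theorem mk_oneSubRpowCoeff_ode (a : ℚ) :
    (1 - X) * (X * d⁄dX ℚ (PowerSeries.mk (oneSubRpowCoeff a))) +
      C a * (X * PowerSeries.mk (oneSubRpowCoeff a)) = 0 := by
  ext n
  rw [sub_mul, one_mul, map_add, map_sub, coeff_C_mul]
  cases n with
  | zero => simp
  | succ n =>
    have : (n : ℚ) + 1 ≠ 0 := by positivity
    simp only [coeff_succ_X_mul, coeff_X_mul_derivative, coeff_mk, oneSubRpowCoeff,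
      coeff_derivative, map_zero]
    field_simp
    ring

theorem mk_ellipticCoeff_ode :
    (1 - X) * (X * d⁄dX ℚ (X * d⁄dX ℚ (PowerSeries.mk ellipticCoeff))) +
      C (1 / 4) * (X * PowerSeries.mk ellipticCoeff) = 0 := by
  ext n
  rw [sub_mul, one_mul, map_add, map_sub, coeff_C_mul]
  cases n with
  | zero => simp
  | succ n =>
    have : (n : ℚ) + 1 ≠ 0 := by positivity
    simp only [coeff_succ_X_mul, coeff_X_mul_derivative, coeff_mk, ellipticCoeff,
      coeff_derivative, map_zero]
    field_simp
    ring

/-- A product of a solution of a first order and a solution of a second order equation. -/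
theorem mul_ode {F G : ℚ⟦X⟧} {s q : ℚ} (hG : (1 - X) * (X * d⁄dX ℚ G) + C s * (X * G) = 0)
    (hF : (1 - X) * (X * d⁄dX ℚ (X * d⁄dX ℚ F)) + C q * (X * F) = 0) :
    X * d⁄dX ℚ (X * d⁄dX ℚ (F * G)) - C 2 * (X * (X * d⁄dX ℚ (X * d⁄dX ℚ (F * G))))
      + X * (X * (X * d⁄dX ℚ (X * d⁄dX ℚ (F * G))))
      + C (2 * s) * (X * (X * d⁄dX ℚ (F * G))) - C (2 * s) * (X * (X * (X * d⁄dX ℚ (F * G))))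
      + C (s * (s + 1)) * (X * (X * (F * G)))
      + C (s + q) * (X * (F * G)) - C (s + q) * (X * (X * (F * G))) = 0 := by
  have hG' := congrArg (fun H => X * d⁄dX ℚ H) hG
  simp only [map_add, map_sub, map_mul, map_one, map_zero, Derivation.leibniz, smul_eq_mul,
    derivative_X, derivative_C, Derivation.map_one_eq_zero, map_ofNat] at hG' hF ⊢
  linear_combination (1 - X) * G * hF + 2 * (1 - X) * (X * d⁄dX ℚ F) * hG
    + F * (1 - X) * hG' + F * (X - C s * X + 2 * C s * X) * hG

theorem ellipticMulCoeff_succ_succ (n : ℕ) :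
    ((n : ℚ) + 2) ^ 2 * ellipticMulCoeff (n + 2) =
      (2 * (n + 1) ^ 2 - 7 / 4 * (n + 1) - 9 / 8) * ellipticMulCoeff (n + 1)
        - (n - 11 / 8) * (n - 3 / 8) * ellipticMulCoeff n := by
  have hW : PowerSeries.mk ellipticMulCoeff =
      PowerSeries.mk ellipticCoeff * PowerSeries.mk (oneSubRpowCoeff (7 / 8)) := by
    ext n
    simp [coeff_mul, ellipticMulCoeff]
  have h := mul_ode (mk_oneSubRpowCoeff_ode (7 / 8)) mk_ellipticCoeff_ode
  rw [← hW, show (7 / 8 + 1 / 4 : ℚ) = 9 / 8 by norm_num] at h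
  have h2 := congrArg (coeff (n + 2)) h
  simp only [map_add, map_sub, coeff_C_mul, map_zero] at h2
  simp only [coeff_succ_X_mul] at h2
  simp only [coeff_X_mul_derivative, coeff_derivative, coeff_mk] at h2
  push_cast at h2
  linear_combination h2

end Recurrence

/-- The quadruple `(ellipticMulCoeff n, ellipticMulCoeff (n + 1), ellipticCoeff n,
oneSubRpowCoeff (11 / 8) n)`, computed by recurrence. -/
def coeffState : ℕ → ℚ × ℚ × ℚ × ℚ
  | 0 => (1, -9 / 8, 1, 1)
  | n + 1 =>
    let s := coeffState n
    (s.2.1, ((2 * (n + 1) ^ 2 - 7 / 4 * (n + 1) - 9 / 8) * s.2.1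
        - (n - 11 / 8) * (n - 3 / 8) * s.1) / (n + 2) ^ 2,
      s.2.2.1 * ((n ^ 2 - 1 / 4) / (n + 1) ^ 2), s.2.2.2 * ((n - 11 / 8) / (n + 1)))

theorem coeffState_eq (n : ℕ) :
    coeffState n = (ellipticMulCoeff n, ellipticMulCoeff (n + 1), ellipticCoeff n,
      oneSubRpowCoeff (11 / 8) n) := by
  induction n with
  | zero =>
    simp [coeffState, ellipticMulCoeff, ellipticCoeff, oneSubRpowCoeff,
      Finset.Nat.antidiagonal_succ]
    norm_num
  | succ n ih =>
    have h := ellipticMulCoeff_succ_succ n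
    have : (n : ℚ) + 2 ≠ 0 := by positivity
    simp only [coeffState, ih, ellipticCoeff, oneSubRpowCoeff, Prod.mk.injEq, true_and, and_true]
    rw [← h]
    field_simp

theorem coeffState_check :
    (∀ n < 101, n ≠ 0 → 0 ≤ (coeffState n).2.2.1 - (coeffState n).1
      + 7 / 11 * (coeffState n).2.2.2) ∧
    0 < (coeffState 7).2.2.1 - (coeffState 7).1 + 7 / 11 * (coeffState 7).2.2.2 ∧
    (coeffState 100).1 < 0 ∧ 0 ≤ (coeffState 100).2.2.2 ∧
    3 * (7 / 11 * (coeffState 100).2.2.2) ≤ -(coeffState 100).1 ∧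
    (101 ^ 2 - 15 / 8 * 101 + 1) * -(coeffState 100).1 ≤ 101 ^ 2 * -(coeffState 100).2.1 := by
  decide +kernel

/-- The induction step for the tail of the defect coefficients: here `p`, `q`, `r` are three
consecutive values of `-ellipticMulCoeff`, `b` is `7 / 11 * oneSubRpowCoeff (11 / 8) n` and `f` is
`ellipticCoeff n`. -/
theorem defect_step {x p q r b f : ℚ} (hx : 100 ≤ x) (hp : 0 < p) (hb : 0 ≤ b)
    (hpb : 3 * b ≤ p) (hpp : ((x + 1) ^ 2 - 15 / 8 * (x + 1) + 1) * p ≤ (x + 1) ^ 2 * q)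
    (hc : 0 ≤ f + p + b)
    (hrec : (x + 2) ^ 2 * r =
      (2 * (x + 1) ^ 2 - 7 / 4 * (x + 1) - 9 / 8) * q - (x - 11 / 8) * (x - 3 / 8) * p) :
    0 < q ∧ 0 ≤ b * ((x - 11 / 8) / (x + 1)) ∧ 3 * (b * ((x - 11 / 8) / (x + 1))) ≤ q ∧
      ((x + 2) ^ 2 - 15 / 8 * (x + 2) + 1) * q ≤ (x + 2) ^ 2 * r ∧
      0 ≤ f * ((x ^ 2 - 1 / 4) / (x + 1) ^ 2) + q + b * ((x - 11 / 8) / (x + 1)) := by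
  have hx1 : 0 < (x + 1) ^ 2 := by positivity
  have hk : 0 < (x + 1) ^ 2 - 15 / 8 * (x + 1) + 1 := by nlinarith
  have hq : 0 < q := pos_of_mul_pos_right (lt_of_lt_of_le (mul_pos hk hp) hpp) hx1.le
  have e1 : b * ((x - 11 / 8) / (x + 1)) = b * ((x - 11 / 8) * (x + 1)) / (x + 1) ^ 2 := by
    field_simp
  have hlow : ((x + 1) ^ 2 - 15 / 8 * (x + 1) + 1) * p / (x + 1) ^ 2 ≤ q := by
    rw [div_le_iff₀ hx1]; linarith
  refine ⟨hq, mul_nonneg hb (div_nonneg (by linarith) (by linarith)), ?_, ?_, ?_⟩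
  · refine le_trans ?_ hlow
    rw [e1, ← mul_div_assoc, div_le_div_iff_of_pos_right hx1]
    have : (x - 11 / 8) * (x + 1) * (3 * b) ≤ (x - 11 / 8) * (x + 1) * p :=
      mul_le_mul_of_nonneg_left hpb (mul_nonneg (by linarith) (by linarith))
    nlinarith
  · rw [hrec]
    have hB : 0 ≤ (x - 11 / 8) * (x - 3 / 8) := mul_nonneg (by linarith) (by linarith)
    have h1 : (x - 11 / 8) * (x - 3 / 8) * p ≤ (x - 11 / 8) * (x - 3 / 8) *
        ((x + 1) ^ 2 * q / ((x + 1) ^ 2 - 15 / 8 * (x + 1) + 1)) := by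
      refine mul_le_mul_of_nonneg_left ?_ hB
      rw [le_div_iff₀ hk]; linarith
    have h2 : (x - 11 / 8) * (x - 3 / 8) *
        ((x + 1) ^ 2 * q / ((x + 1) ^ 2 - 15 / 8 * (x + 1) + 1)) ≤
        ((2 * (x + 1) ^ 2 - 7 / 4 * (x + 1) - 9 / 8)
          - ((x + 2) ^ 2 - 15 / 8 * (x + 2) + 1)) * q := by
      rw [← mul_div_assoc, div_le_iff₀ hk]
      have h3 : (x - 11 / 8) * (x - 3 / 8) * (x + 1) ^ 2 ≤
        ((2 * (x + 1) ^ 2 - 7 / 4 * (x + 1) - 9 / 8)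
          - ((x + 2) ^ 2 - 15 / 8 * (x + 2) + 1)) * ((x + 1) ^ 2 - 15 / 8 * (x + 1) + 1) := by
        nlinarith
      nlinarith
    linarith
  · have h1 : -(p + b) * ((x ^ 2 - 1 / 4) / (x + 1) ^ 2) ≤ f * ((x ^ 2 - 1 / 4) / (x + 1) ^ 2) :=
      mul_le_mul_of_nonneg_right (by linarith) (div_nonneg (by nlinarith) hx1.le)
    have h2 : 0 ≤ -(p + b) * ((x ^ 2 - 1 / 4) / (x + 1) ^ 2) +
        ((x + 1) ^ 2 - 15 / 8 * (x + 1) + 1) * p / (x + 1) ^ 2 +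
        b * ((x - 11 / 8) * (x + 1)) / (x + 1) ^ 2 := by
      rw [← mul_div_assoc, ← add_div, ← add_div]
      refine div_nonneg ?_ hx1.le
      nlinarith
    rw [e1]
    linarith

theorem defectCoeff_zero : defectCoeff 0 = 0 := by
  simp [defectCoeff, ellipticCoeff, ellipticMulCoeff, oneSubRpowCoeff]

theorem defectCoeff_one : defectCoeff 1 = 0 := by
  simp [defectCoeff, ellipticCoeff, ellipticMulCoeff, oneSubRpowCoeff,
    Finset.Nat.antidiagonal_succ]
  norm_num

theorem defectCoeff_of_ne_zero {n : ℕ} (hn : n ≠ 0) :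
    defectCoeff n = (coeffState n).2.2.1 - (coeffState n).1 + 7 / 11 * (coeffState n).2.2.2 := by
  simp [defectCoeff, hn, coeffState_eq]

theorem defectCoeff_seven_pos : 0 < defectCoeff 7 := by
  rw [defectCoeff_of_ne_zero (by norm_num)]
  exact coeffState_check.2.1

theorem defectCoeff_nonneg (n : ℕ) : 0 ≤ defectCoeff n := by
  obtain ⟨hsmall, -, h1, h2, h3, h4⟩ := coeffState_check
  rcases eq_or_ne n 0 with rfl | hn
  · exact defectCoeff_zero.ge
  rw [defectCoeff_of_ne_zero hn]
  rcases lt_or_ge n 101 with hlt | hge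
  · exact hsmall n hlt hn
  have h5 := hsmall 100 (by norm_num) (by norm_num)
  simp only [coeffState_eq] at h1 h2 h3 h4 h5 ⊢
  have key : ∀ m : ℕ, 100 ≤ m → 0 < -ellipticMulCoeff m ∧
      0 ≤ 7 / 11 * oneSubRpowCoeff (11 / 8) m ∧
      3 * (7 / 11 * oneSubRpowCoeff (11 / 8) m) ≤ -ellipticMulCoeff m ∧
      (((m : ℚ) + 1) ^ 2 - 15 / 8 * (m + 1) + 1) * -ellipticMulCoeff m ≤
        ((m : ℚ) + 1) ^ 2 * -ellipticMulCoeff (m + 1) ∧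
      0 ≤ ellipticCoeff m + -ellipticMulCoeff m + 7 / 11 * oneSubRpowCoeff (11 / 8) m := by
    intro m hm
    induction m, hm using Nat.le_induction with
    | base =>
      refine ⟨by linarith, by linarith, h3, ?_, by linarith⟩
      norm_num at h4 ⊢
      exact h4
    | succ m hm ih =>
      obtain ⟨i1, i2, i3, i4, i5⟩ := ih
      have hrec := ellipticMulCoeff_succ_succ m
      have := defect_step (x := m) (r := -ellipticMulCoeff (m + 2)) (by exact_mod_cast hm)
        i1 i2 i3 i4 i5 (by linarith)
      simp only [ellipticCoeff, oneSubRpowCoeff, ← mul_assoc] at this ⊢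
      push_cast
      rw [show (m : ℚ) + 1 + 1 = m + 2 by ring]
      exact this
  have := (key n (by omega)).2.2.2.2
  linarith

theorem ringChoose_eq_oneSubRpowCoeff (a : ℚ) (n : ℕ) :
    Ring.choose (a : ℝ) n = (-1) ^ n * (oneSubRpowCoeff a n : ℝ) := by
  induction n with
  | zero => simp [oneSubRpowCoeff]
  | succ n ih =>
    have h : Ring.choose (a : ℝ) (n + 1) = Ring.choose (a : ℝ) n * ((a - n) / (n + 1)) := by
      have : (n : ℝ) + 1 ≠ 0 := by positivity
      have : (n.factorial : ℝ) ≠ 0 := by positivity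
      simp only [Ring.choose_eq_smul, descPochhammer_succ_right, Polynomial.smeval_mul,
        Polynomial.smeval_sub, Polynomial.smeval_X, Polynomial.smeval_natCast, Nat.factorial_succ,
        smul_eq_mul, pow_one, pow_zero, nsmul_eq_mul, mul_one]
      push_cast
      field_simp
    rw [h, ih]
    simp only [oneSubRpowCoeff]
    push_cast
    ring

theorem hasSum_oneSubRpowCoeff (a : ℚ) {u : ℝ} (hu : |u| < 1) :
    HasSum (fun n => (oneSubRpowCoeff a n : ℝ) * u ^ n) ((1 - u) ^ (a : ℝ)) := by
  have h := (Real.one_add_rpow_hasFPowerSeriesOnBall_zero (a := (a : ℝ))).hasSum (y := -u)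
    (by simpa [enorm_eq_nnnorm, ← NNReal.coe_lt_coe] using hu)
  simp only [binomialSeries_apply, List.ofFn_const, List.prod_replicate, smul_eq_mul, zero_add,
    ringChoose_eq_oneSubRpowCoeff] at h
  have e : ∀ n : ℕ, (-1) ^ n * (oneSubRpowCoeff a n : ℝ) * (-u) ^ n =
      oneSubRpowCoeff a n * u ^ n := by
    intro n
    have : ((-1 : ℝ) ^ n) * (-1) ^ n = 1 := by rw [← mul_pow]; simp
    rw [neg_pow u n]
    linear_combination ((oneSubRpowCoeff a n : ℝ) * u ^ n) * this
  simpa only [e, zero_sub, ← sub_eq_add_neg] using h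

theorem integral_sin_pow_two_mul (n : ℕ) :
    ∫ t in (0 : ℝ)..(π / 2), Real.sin t ^ (2 * n) = π / 2 * oneSubRpowCoeff (-1 / 2) n := by
  induction n with
  | zero => simp [oneSubRpowCoeff]
  | succ n ih =>
    have : (n : ℝ) + 1 ≠ 0 := by positivity
    rw [mul_add, mul_one, integral_sin_pow, ih]
    simp only [oneSubRpowCoeff, Real.cos_pi_div_two, Real.sin_zero]
    push_cast
    rw [zero_pow (by omega)]
    field_simp
    ring

theorem hasSum_ellipticCoeff {u : ℝ} (h0 : 0 ≤ u) (h1 : u < 1) :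
    HasSum (fun n => (ellipticCoeff n : ℝ) * u ^ n) (2 / π * ellipticE (√u)) := by
  have habs : |u| < 1 := by rwa [abs_of_nonneg h0]
  have hsum : Summable fun n => |(oneSubRpowCoeff (1 / 2) n : ℝ) * u ^ n| :=
    (hasSum_oneSubRpowCoeff (1 / 2) habs).summable.abs
  have h := intervalIntegral.hasSum_integral_of_dominated_convergence
    (μ := MeasureTheory.volume) (a := 0) (b := π / 2)
    (F := fun n t => (oneSubRpowCoeff (1 / 2) n : ℝ) * (u * Real.sin t ^ 2) ^ n)
    (f := fun t => √(1 - √u ^ 2 * Real.sin t ^ 2))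
    (fun n _ => |(oneSubRpowCoeff (1 / 2) n : ℝ) * u ^ n|)
    (fun n => (by fun_prop : Continuous _).aestronglyMeasurable)
    (fun n => Filter.Eventually.of_forall fun t _ => by
      rw [mul_pow, ← mul_assoc, norm_mul, Real.norm_eq_abs]
      refine mul_le_of_le_one_right (abs_nonneg _) ?_
      rw [norm_pow, norm_pow, Real.norm_eq_abs, sq_abs]
      exact pow_le_one₀ (sq_nonneg _) (Real.sin_sq_le_one t))
    (Filter.Eventually.of_forall fun _ _ => hsum)
    intervalIntegrable_const
    (Filter.Eventually.of_forall fun t _ => by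
      have hle : u * Real.sin t ^ 2 ≤ u := mul_le_of_le_one_right h0 (Real.sin_sq_le_one t)
      have := hasSum_oneSubRpowCoeff (1 / 2) (u := u * Real.sin t ^ 2)
        (by rw [abs_of_nonneg (by positivity)]; linarith)
      rw [Real.sq_sqrt h0, Real.sqrt_eq_rpow]
      simpa using this)
  refine (h.mul_left (2 / π)).congr_fun fun n => ?_
  simp only [mul_pow, ← pow_mul]
  rw [intervalIntegral.integral_const_mul, intervalIntegral.integral_const_mul,
    integral_sin_pow_two_mul, ellipticCoeff_eq_mul]
  push_cast
  field_simp

theorem hasSum_defectCoeff {u : ℝ} (h0 : 0 ≤ u) (h1 : u < 1) :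
    HasSum (fun n => (defectCoeff n : ℝ) * u ^ n)
      (2 / π * ellipticE (√u) * (1 - (1 - u) ^ (7 / 8 : ℝ))
        - 7 / 11 * (1 - (1 - u) ^ (11 / 8 : ℝ))) := by
  have habs : |u| < 1 := by rwa [abs_of_nonneg h0]
  have hE := hasSum_ellipticCoeff h0 h1
  have hG := hasSum_oneSubRpowCoeff (7 / 8) habs
  have hB := hasSum_oneSubRpowCoeff (11 / 8) habs
  have hW : HasSum (fun n => (ellipticMulCoeff n : ℝ) * u ^ n)
      (2 / π * ellipticE (√u) * (1 - u) ^ ((7 / 8 : ℚ) : ℝ)) := by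
    have hs := summable_norm_sum_mul_antidiagonal_of_summable_norm hE.summable.norm hG.summable.norm
    have ht := tsum_mul_tsum_eq_tsum_sum_antidiagonal_of_summable_norm
      hE.summable.norm hG.summable.norm
    rw [hE.tsum_eq, hG.tsum_eq] at ht
    rw [ht]
    refine hs.of_norm.hasSum.congr_fun fun n => ?_
    simp only [ellipticMulCoeff]
    push_cast
    rw [Finset.sum_mul]
    refine Finset.sum_congr rfl fun p hp => ?_
    rw [← Finset.HasAntidiagonal.mem_antidiagonal.mp hp]
    ring
  have hc : HasSum (fun n : ℕ => if n = 0 then (7 / 11 : ℝ) else 0) (7 / 11) :=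
    hasSum_ite_eq 0 _
  have hval : 2 / π * ellipticE (√u) * (1 - (1 - u) ^ (7 / 8 : ℝ))
        - 7 / 11 * (1 - (1 - u) ^ (11 / 8 : ℝ)) =
      2 / π * ellipticE (√u) - 2 / π * ellipticE (√u) * (1 - u) ^ ((7 / 8 : ℚ) : ℝ)
        + 7 / 11 * (1 - u) ^ ((11 / 8 : ℚ) : ℝ) - 7 / 11 := by
    push_cast
    ring
  rw [hval]
  refine (((hE.sub hW).add (hB.mul_left (7 / 11))).sub hc).congr_fun fun n => ?_
  simp only [defectCoeff]
  split_ifs with hn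
  · subst hn; push_cast; ring
  · push_cast; ring

theorem ellipticE_nonneg (r : ℝ) : 0 ≤ ellipticE r :=
  intervalIntegral.integral_nonneg (by positivity) fun _ _ => Real.sqrt_nonneg _

theorem ellipticE_sqrt_le {u : ℝ} (h0 : 0 ≤ u) (h1 : u ≤ 1) :
    ellipticE (√u) ≤ 1 + π / 2 * √(1 - u) := by
  have h : ellipticE (√u) ≤ ∫ t in (0 : ℝ)..(π / 2), (Real.cos t + √(1 - u)) := by
    refine intervalIntegral.integral_mono_on (by positivity)
      (Continuous.intervalIntegrable (by fun_prop) _ _)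
      (Continuous.intervalIntegrable (by fun_prop) _ _) fun t ht => ?_
    have hcos : 0 ≤ Real.cos t :=
      Real.cos_nonneg_of_mem_Icc ⟨by linarith [ht.1, Real.pi_pos], ht.2⟩
    have hs : 0 ≤ √(1 - u) := Real.sqrt_nonneg _
    refine Real.sqrt_le_iff.mpr ⟨by positivity, ?_⟩
    have hsq := Real.sq_sqrt (sub_nonneg.mpr h1)
    rw [Real.sq_sqrt h0]
    nlinarith [mul_nonneg hcos hs, Real.sin_sq_add_cos_sq t, Real.sin_sq_le_one t,
      mul_nonneg (sub_nonneg.mpr h1) (sub_nonneg.mpr (Real.sin_sq_le_one t))]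
  rw [intervalIntegral.integral_add (Continuous.intervalIntegrable (by fun_prop) _ _)
    (Continuous.intervalIntegrable (by fun_prop) _ _)] at h
  simpa using h

/-- The series expansion has nonnegative coefficients and no terms of degree below two. -/
theorem defect_le {u v : ℝ} (h0 : 0 < u) (huv : u ≤ v) (h1 : v < 1) :
    (2 / π * ellipticE (√u) * (1 - (1 - u) ^ (7 / 8 : ℝ))
        - 7 / 11 * (1 - (1 - u) ^ (11 / 8 : ℝ))) ≤
      (u / v) ^ 2 * (2 / π * ellipticE (√v) * (1 - (1 - v) ^ (7 / 8 : ℝ))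
        - 7 / 11 * (1 - (1 - v) ^ (11 / 8 : ℝ))) := by
  have hv : 0 < v := h0.trans_le huv
  refine hasSum_le (fun n => ?_) (hasSum_defectCoeff h0.le (huv.trans_lt h1))
    ((hasSum_defectCoeff hv.le h1).mul_left _)
  match n with
  | 0 => simp [defectCoeff_zero]
  | 1 => simp [defectCoeff_one]
  | n + 2 =>
    have hc : (0 : ℝ) ≤ defectCoeff (n + 2) := by exact_mod_cast defectCoeff_nonneg (n + 2)
    have : (u / v) ^ 2 * (defectCoeff (n + 2) * v ^ (n + 2)) =
        defectCoeff (n + 2) * (u ^ 2 * v ^ n) := by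
      field_simp
      ring
    rw [this, pow_add, mul_comm (u ^ n)]
    gcongr

theorem defect_pos {u : ℝ} (h0 : 0 < u) (h1 : u < 1) :
    0 < 2 / π * ellipticE (√u) * (1 - (1 - u) ^ (7 / 8 : ℝ))
        - 7 / 11 * (1 - (1 - u) ^ (11 / 8 : ℝ)) := by
  have h := hasSum_defectCoeff h0.le h1
  rw [← h.tsum_eq]
  refine h.summable.tsum_pos (fun n => ?_) 7 ?_
  · have hc : (0 : ℝ) ≤ defectCoeff n := by exact_mod_cast defectCoeff_nonneg n
    positivity
  · have hc : (0 : ℝ) < defectCoeff 7 := by exact_mod_cast defectCoeff_seven_pos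
    positivity

theorem defect_le_sq {u : ℝ} (h0 : 0 < u) (h1 : u < 1) :
    2 / π * ellipticE (√u) * (1 - (1 - u) ^ (7 / 8 : ℝ))
        - 7 / 11 * (1 - (1 - u) ^ (11 / 8 : ℝ)) ≤ u ^ 2 * (2 / π - 7 / 11) := by
  have hlim : Filter.Tendsto (fun v : ℝ => (u / v) ^ 2 * (2 / π + √(1 - v) - 7 / 11 * v))
      (nhdsWithin 1 (Set.Iio 1)) (nhds (u ^ 2 * (2 / π - 7 / 11))) := by
    have : ContinuousAt (fun v : ℝ => (u / v) ^ 2 * (2 / π + √(1 - v) - 7 / 11 * v)) 1 := by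
      fun_prop (disch := norm_num)
    have h := this.tendsto.mono_left (nhdsWithin_le_nhds (s := Set.Iio 1))
    simpa using h
  refine ge_of_tendsto hlim ?_
  filter_upwards [Ioo_mem_nhdsLT h1] with v hv
  have hv0 : 0 < v := h0.trans hv.1
  refine (defect_le h0 hv.1.le hv.2).trans (mul_le_mul_of_nonneg_left ?_ (sq_nonneg _))
  have hE := ellipticE_sqrt_le hv0.le hv.2.le
  have hE' : 2 / π * ellipticE (√v) ≤ 2 / π + √(1 - v) := by
    have := mul_le_mul_of_nonneg_left hE (by positivity : 0 ≤ 2 / π)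
    calc _ ≤ _ := this
      _ = _ := by field_simp
  have hE0 : 0 ≤ 2 / π * ellipticE (√v) := mul_nonneg (by positivity) (ellipticE_nonneg _)
  have hg : 0 ≤ (1 - v) ^ (7 / 8 : ℝ) := Real.rpow_nonneg (by linarith [hv.2]) _
  have hb : (1 - v) ^ (11 / 8 : ℝ) ≤ 1 - v :=
    Real.rpow_le_self_of_le_one (by linarith [hv.2]) (by linarith) (by norm_num)
  nlinarith [mul_nonneg hE0 hg]

theorem ellipticE_S117_bounds (r : ℝ) (hr : r ∈ Set.Ioo (0:ℝ) 1) :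
    S117 (Real.sqrt (1 - r ^ 2)) < 2 / π * ellipticE r ∧
    2 / π * ellipticE r < 22 / (7 * π) * S117 (Real.sqrt (1 - r ^ 2)) := by
  obtain ⟨hr0, hr1⟩ := hr
  have hu0 : 0 < r ^ 2 := by positivity
  have hu1 : r ^ 2 < 1 := by nlinarith
  have hlow := defect_pos hu0 hu1
  have hup := defect_le_sq hu0 hu1
  have hb : (1 - r ^ 2) ^ (11 / 8 : ℝ) ≤ 1 - r ^ 2 :=
    Real.rpow_le_self_of_le_one (by linarith) (by linarith) (by norm_num)
  have hg : (1 - r ^ 2) ^ (7 / 8 : ℝ) < 1 :=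
    Real.rpow_lt_one (by linarith) (by linarith) (by norm_num)
  have e1 : √(1 - r ^ 2) ^ ((11 : ℝ) / 4) = (1 - r ^ 2) ^ (11 / 8 : ℝ) := by
    rw [Real.sqrt_eq_rpow, ← Real.rpow_mul (by linarith)]
    norm_num
  have e2 : √(1 - r ^ 2) ^ ((7 : ℝ) / 4) = (1 - r ^ 2) ^ (7 / 8 : ℝ) := by
    rw [Real.sqrt_eq_rpow, ← Real.rpow_mul (by linarith)]
    norm_num
  have hpi : 0 < 2 / π - 7 / 11 := by
    rw [sub_pos, div_lt_div_iff₀ (by norm_num) Real.pi_pos]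
    linarith [Real.pi_lt_d4]
  have hsq : r ^ 2 * r ^ 2 < r ^ 2 := mul_lt_of_lt_one_right hu0 hu1
  rw [Real.sqrt_sq hr0.le] at hlow hup
  rw [S117, e1, e2]
  constructor
  · rw [div_lt_iff₀ (by linarith)]
    linarith
  · rw [← mul_div_assoc, lt_div_iff₀ (by linarith)]
    have : 22 / (7 * π) * (7 / 11 * (1 - (1 - r ^ 2) ^ (11 / 8 : ℝ))) =
        2 / π * (1 - (1 - r ^ 2) ^ (11 / 8 : ℝ)) := by
      field_simp
      ring
    rw [this]
    nlinarith
end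

section
/- For all r ∈ (0,1), 0 < (2/π) E(r) − S_{11/4,7/4}(1, √(1−r²)) < 2/π − 7/11, where E is the complete elliptic integral of the second kind and S_{11/4,7/4}(1,x) = (7/11)(1−x^{11/4})/(1−x^{7/4}). -/
open Real

/-- The coefficients of the binomial series of `√(1 + z)`. -/
noncomputable def sqrtCoeff (n : ℕ) : ℝ := Ring.choose (1 / 2 : ℝ) n

lemma sqrtCoeff_zero : sqrtCoeff 0 = 1 := by simp [sqrtCoeff]

lemma sqrtCoeff_succ (n : ℕ) : sqrtCoeff (n + 1) = (1 / 2 - n) / (n + 1) * sqrtCoeff n := by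
  simp only [sqrtCoeff, Ring.choose_eq_smul, descPochhammer_succ_right, Polynomial.smeval_mul,
    Polynomial.smeval_sub, Polynomial.smeval_X, Polynomial.smeval_natCast, Nat.factorial_succ,
    smul_eq_mul, Nat.cast_mul, Nat.cast_succ, mul_inv, pow_one, pow_zero, nsmul_eq_mul, mul_one]
  field_simp

lemma sq_sqrtCoeff_succ_le (n : ℕ) : sqrtCoeff (n + 1) ^ 2 ≤ sqrtCoeff n ^ 2 := by
  rw [sqrtCoeff_succ, mul_pow]
  refine mul_le_of_le_one_left (sq_nonneg _) ?_
  have hn : (0 : ℝ) ≤ n := n.cast_nonneg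
  rw [sq_le_one_iff_abs_le_one, abs_le]
  constructor
  · rw [le_div_iff₀ (by positivity)]; linarith
  · rw [div_le_one (by positivity)]; linarith

lemma antitone_sq_sqrtCoeff : Antitone fun n => sqrtCoeff n ^ 2 :=
  antitone_nat_of_succ_le sq_sqrtCoeff_succ_le

lemma abs_sqrtCoeff_le_one (n : ℕ) : |sqrtCoeff n| ≤ 1 := by
  rw [← sq_le_one_iff_abs_le_one]
  simpa [sqrtCoeff_zero] using antitone_sq_sqrtCoeff (Nat.zero_le n)

lemma hasSum_sqrtCoeff_mul_pow {z : ℂ} (hz : ‖z‖ < 1) :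
    HasSum (fun n => (sqrtCoeff n : ℂ) * z ^ n) ((1 + z) ^ (1 / 2 : ℂ)) := by
  have h := (Complex.one_add_cpow_hasFPowerSeriesOnBall_zero (a := 1 / 2)).hasSum (y := z)
    (by rw [← ENNReal.ofReal_one, Metric.eball_ofReal]; simpa using hz)
  simp only [binomialSeries_apply, List.ofFn_const, List.prod_replicate, smul_eq_mul,
    zero_add] at h
  have e (n : ℕ) : (sqrtCoeff n : ℂ) = Ring.choose (1 / 2 : ℂ) n := by
    rw [sqrtCoeff, Complex.ofReal_choose]
    norm_num
  simpa only [e] using h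

lemma normSq_sqrt_one_add (l θ : ℝ) :
    ‖(1 + l * Complex.exp (θ * Complex.I)) ^ (1 / 2 : ℂ)‖ ^ 2 =
      √(1 + l ^ 2 + 2 * l * cos θ) := by
  rw [← norm_pow, ← Complex.cpow_nat_mul]
  norm_num
  rw [Complex.norm_def, Complex.normSq_apply]
  congr 1
  simp [Complex.exp_re, Complex.exp_im]
  nlinarith [sin_sq_add_cos_sq θ]

lemma hasSum_re_mul_conj {f : ℕ → ℂ} {w : ℂ} (h : HasSum f w) (hs : Summable fun n => ‖f n‖) :
    HasSum (fun p : ℕ × ℕ => (f p.1 * (starRingEnd ℂ) (f p.2)).re) (‖w‖ ^ 2) := by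
  obtain ⟨g, hg⟩ : ∃ g : ℕ → ℂ, ∀ n, g n = (starRingEnd ℂ) (f n) := ⟨_, fun _ => rfl⟩
  have hc : HasSum g ((starRingEnd ℂ) w) :=
    (h.map (starRingEnd ℂ) Complex.continuous_conj).congr_fun hg
  have hsc : Summable fun n => ‖g n‖ := by simpa only [hg, RCLike.norm_conj] using hs
  have hm := Complex.hasSum_re (HasSum.mul h hc (summable_mul_of_summable_norm hs hsc))
  rw [Complex.mul_conj, Complex.normSq_eq_norm_sq, Complex.ofReal_re] at hm
  simpa only [hg] using hm

lemma hasSum_sqrt_cos {l : ℝ} (hl : 0 ≤ l) (hl1 : l < 1) (θ : ℝ) :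
    HasSum (fun p : ℕ × ℕ => sqrtCoeff p.1 * sqrtCoeff p.2 * l ^ (p.1 + p.2) *
      cos (((p.1 : ℝ) - p.2) * θ)) √(1 + l ^ 2 + 2 * l * cos θ) := by
  set z : ℂ := l * Complex.exp (θ * Complex.I) with hz
  have hzn : ‖z‖ = l := by simp [hz, Complex.norm_exp_ofReal_mul_I, abs_of_nonneg hl]
  have h := hasSum_sqrtCoeff_mul_pow (z := z) (by rwa [hzn])
  have hs : Summable fun n => ‖(sqrtCoeff n : ℂ) * z ^ n‖ := by
    refine (summable_geometric_of_lt_one hl hl1).of_nonneg_of_le (fun _ => norm_nonneg _)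
      fun n => ?_
    rw [norm_mul, norm_pow, hzn, Complex.norm_real]
    exact mul_le_of_le_one_left (by positivity) (abs_sqrtCoeff_le_one n)
  have hm := hasSum_re_mul_conj h hs
  rw [← normSq_sqrt_one_add]
  refine hm.congr_fun fun p => ?_
  have e : (sqrtCoeff p.1 * z ^ p.1) * (starRingEnd ℂ) (sqrtCoeff p.2 * z ^ p.2) =
      ((sqrtCoeff p.1 * sqrtCoeff p.2 * l ^ (p.1 + p.2) : ℝ) : ℂ) *
        Complex.exp ((((p.1 : ℝ) - p.2) * θ : ℝ) * Complex.I) := by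
    simp only [hz, map_mul, map_pow, Complex.conj_ofReal, map_natCast,
      ← Complex.exp_conj, Complex.conj_I, mul_pow, ← Complex.exp_nat_mul]
    rw [show (((((p.1 : ℝ) - p.2) * θ : ℝ) : ℂ)) * Complex.I =
      (p.1 : ℂ) * (θ * Complex.I) + (p.2 : ℂ) * (θ * -Complex.I) by push_cast; ring,
      Complex.exp_add]
    push_cast
    ring
  rw [e, Complex.re_ofReal_mul, Complex.exp_ofReal_mul_I_re]

lemma integral_cos_sub_mul (m n : ℕ) :
    ∫ t in (0:ℝ)..(π / 2), cos (((m : ℝ) - n) * (2 * t)) = if m = n then π / 2 else 0 := by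
  split_ifs with h
  · simp [h]
  · have h0 : ((m : ℝ) - n) * 2 ≠ 0 := by
      simpa [sub_eq_zero] using h
    simp_rw [← mul_assoc]
    rw [intervalIntegral.integral_comp_mul_left _ h0, integral_cos,
      show ((m : ℝ) - n) * 2 * (π / 2) = ((m - n : ℤ) : ℝ) * π by push_cast; ring, sin_int_mul_pi]
    simp

lemma hasSum_integral_sqrt_cos {l : ℝ} (hl : 0 ≤ l) (hl1 : l < 1) :
    HasSum (fun n => π / 2 * (sqrtCoeff n ^ 2 * (l ^ 2) ^ n))
      (∫ t in (0:ℝ)..(π / 2), √(1 + l ^ 2 + 2 * l * cos (2 * t))) := by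
  have hg := summable_geometric_of_lt_one hl hl1
  have hb : Summable fun p : ℕ × ℕ => l ^ (p.1 + p.2) := by
    simpa only [pow_add] using hg.mul_of_nonneg hg (fun _ => by positivity) fun _ => by positivity
  have h := intervalIntegral.hasSum_integral_of_dominated_convergence (a := 0) (b := π / 2)
    (μ := MeasureTheory.volume)
    (F := fun (p : ℕ × ℕ) t => sqrtCoeff p.1 * sqrtCoeff p.2 * l ^ (p.1 + p.2) *
      cos (((p.1 : ℝ) - p.2) * (2 * t)))
    (f := fun t => √(1 + l ^ 2 + 2 * l * cos (2 * t)))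
    (fun p _ => l ^ (p.1 + p.2)) (fun p => by fun_prop)
    (fun p => .of_forall fun t _ => by
      rw [norm_mul, norm_mul, norm_mul, Real.norm_eq_abs, Real.norm_eq_abs, Real.norm_eq_abs,
        Real.norm_eq_abs, abs_of_nonneg (pow_nonneg hl _)]
      have h1 := mul_le_one₀ (abs_sqrtCoeff_le_one p.1) (abs_nonneg _) (abs_sqrtCoeff_le_one p.2)
      have h2 := abs_cos_le_one (((p.1 : ℝ) - p.2) * (2 * t))
      calc _ ≤ 1 * l ^ (p.1 + p.2) * 1 := by gcongr
        _ = _ := by ring)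
    (.of_forall fun t _ => hb) (by simp)
    (.of_forall fun t _ => hasSum_sqrt_cos hl hl1 (2 * t))
  simp only [intervalIntegral.integral_const_mul, integral_cos_sub_mul] at h
  have hinj : Function.Injective fun n : ℕ => (n, n) := fun a b h => (Prod.mk.inj h).1
  rw [← hinj.hasSum_iff] at h
  · refine h.congr_fun fun n => ?_
    simp only [Function.comp_apply, if_true]
    ring
  · rintro ⟨m, n⟩ hmn
    have : m ≠ n := by rintro rfl; exact hmn ⟨m, rfl⟩
    simp [this]

/-- A polynomial whose coefficients change sign once, from nonnegative to nonpositive, and which is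
positive at `b`, is positive on `(0, b]`. -/
lemma sum_mul_pow_pos_of_sign_change {a : ℕ → ℝ} {n k : ℕ} {b s : ℝ} (hs : 0 < s) (hsb : s ≤ b)
    (hpos : ∀ i < k, 0 ≤ a i) (hneg : ∀ i < n, k ≤ i → a i ≤ 0)
    (hb : 0 < ∑ i ∈ Finset.range n, a i * b ^ i) : 0 < ∑ i ∈ Finset.range n, a i * s ^ i := by
  have hb0 : 0 < b := hs.trans_le hsb
  have hv : 0 < s / b := by positivity
  have hv1 : s / b ≤ 1 := (div_le_one hb0).2 hsb
  refine (mul_pos (pow_pos hv k) hb).trans_le ?_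
  rw [Finset.mul_sum]
  refine Finset.sum_le_sum fun i hi => ?_
  have e : a i * s ^ i = (s / b) ^ i * (a i * b ^ i) := by rw [div_pow]; field_simp
  rw [e]
  rcases lt_or_ge i k with h | h
  · exact mul_le_mul_of_nonneg_right (pow_le_pow_of_le_one hv.le hv1 h.le)
      (mul_nonneg (hpos i h) (by positivity))
  · exact mul_le_mul_of_nonpos_right (pow_le_pow_of_le_one hv.le hv1 h)
      (mul_nonpos_of_nonpos_of_nonneg (hneg i (Finset.mem_range.1 hi) h) (by positivity))

lemma stolarsky_lt_partial_sum {s : ℝ} (hs : 0 < s) (hs1 : s ≤ 27 / 100) :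
    7 / 11 * ((11 + 165 * s + 462 * s ^ 2 + 330 * s ^ 3 + 55 * s ^ 4 + s ^ 5) /
      (7 + 35 * s + 21 * s ^ 2 + s ^ 3)) <
    (1 + 6 * s + s ^ 2) * ∑ n ∈ Finset.range 8,
      sqrtCoeff n ^ 2 * (16 * s * (1 + s) ^ 2 / (1 + 6 * s + s ^ 2) ^ 2) ^ n := by
  have h := sum_mul_pow_pos_of_sign_change (n := 20) (k := 8) (a := fun i => (([
      88, 5896, 180008, 3308320, 40724792, 296762932, 1077729668, 281923796, -13810190020,
      -57190628924, -107216016556, -106910116676, -97231342780, -145884016760, -130908001112,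
      -62344456824, -20560184720, -7815296432, -2710203760, -50086696] : List ℤ).getD i 0 : ℝ))
    hs hs1
    (fun i hi => by rw [Int.cast_nonneg_iff]; interval_cases i <;> decide)
    (fun i hi hk => by rw [Int.cast_nonpos]; interval_cases i <;> decide)
    (by norm_num [Finset.sum_range_succ])
  norm_num [Finset.sum_range_succ] at h
  rw [← sub_pos]
  have e : (1 + 6 * s + s ^ 2) * ∑ n ∈ Finset.range 8,
        sqrtCoeff n ^ 2 * (16 * s * (1 + s) ^ 2 / (1 + 6 * s + s ^ 2) ^ 2) ^ n -
      7 / 11 * ((11 + 165 * s + 462 * s ^ 2 + 330 * s ^ 3 + 55 * s ^ 4 + s ^ 5) /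
        (7 + 35 * s + 21 * s ^ 2 + s ^ 3)) =
      s ^ 3 * (88 + 5896 * s + 180008 * s ^ 2 + 3308320 * s ^ 3 + 40724792 * s ^ 4 +
          296762932 * s ^ 5 + 1077729668 * s ^ 6 + 281923796 * s ^ 7 - 13810190020 * s ^ 8 -
          57190628924 * s ^ 9 - 107216016556 * s ^ 10 - 106910116676 * s ^ 11 -
          97231342780 * s ^ 12 - 145884016760 * s ^ 13 - 130908001112 * s ^ 14 -
          62344456824 * s ^ 15 - 20560184720 * s ^ 16 - 7815296432 * s ^ 17 -
          2710203760 * s ^ 18 - 50086696 * s ^ 19 + 496958528 * s ^ 20 + 265729156 * s ^ 21 +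
          75693332 * s ^ 22 + 13872100 * s ^ 23 + 1725244 * s ^ 24 + 146084 * s ^ 25 +
          8116 * s ^ 26 + 268 * s ^ 27 + 4 * s ^ 28) /
        (11 * (7 + 35 * s + 21 * s ^ 2 + s ^ 3) * (1 + 6 * s + s ^ 2) ^ 13) := by
    simp only [Finset.sum_range_succ, Finset.sum_range_zero, sqrtCoeff_succ, sqrtCoeff_zero]
    norm_num
    field_simp
    ring
  have hr : 0 ≤ 496958528 * s ^ 20 + 265729156 * s ^ 21 + 75693332 * s ^ 22 +
      13872100 * s ^ 23 + 1725244 * s ^ 24 + 146084 * s ^ 25 + 8116 * s ^ 26 + 268 * s ^ 27 +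
      4 * s ^ 28 := by positivity
  rw [e]
  refine div_pos (mul_pos (by positivity) ?_) (by positivity)
  linarith

lemma partial_sum_lt_stolarsky_add {s : ℝ} (hs : 0 < s) (hs1 : s ≤ 9 / 100) :
    (1 + 6 * s + s ^ 2) * (∑ n ∈ Finset.range 6,
      sqrtCoeff n ^ 2 * (16 * s * (1 + s) ^ 2 / (1 + 6 * s + s ^ 2) ^ 2) ^ n +
      sqrtCoeff 6 ^ 2 * (16 * s * (1 + s) ^ 2 / (1 + 6 * s + s ^ 2) ^ 2) ^ 6 /
        (1 - 16 * s * (1 + s) ^ 2 / (1 + 6 * s + s ^ 2) ^ 2)) <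
    7 / 11 * ((11 + 165 * s + 462 * s ^ 2 + 330 * s ^ 3 + 55 * s ^ 4 + s ^ 5) /
      (7 + 35 * s + 21 * s ^ 2 + s ^ 3)) + (1 + 6 * s + s ^ 2) / 4000 := by
  have h := sum_mul_pow_pos_of_sign_change (n := 28) (k := 5) (a := fun i => (([
      77, 4697, 129283, 1761199, 8951734, -54559874, -1006367134, -18471934198, -217140933137,
      -1296013869037, -4214910036695, -8427424056435, -13345433570524, -18213202745388,
      -14856109644468, -11425085975620, -6401892926885, -2282706843921, -580013434587,
      -106968991527, -4077953594, 0, 0, -209076326, -73400631, -9747323, -623153, -15989] : List ℤ).getD i 0 : ℝ))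
    hs hs1
    (fun i hi => by rw [Int.cast_nonneg_iff]; interval_cases i <;> decide)
    (fun i hi hk => by rw [Int.cast_nonpos]; interval_cases i <;> decide)
    (by norm_num [Finset.sum_range_succ])
  norm_num [Finset.sum_range_succ] at h
  have h1s : 0 < 1 - s := by linarith
  have hq : 1 - 16 * s * (1 + s) ^ 2 / (1 + 6 * s + s ^ 2) ^ 2 =
      (1 - s) ^ 4 / (1 + 6 * s + s ^ 2) ^ 2 := by
    field_simp
    ring
  rw [← sub_pos, hq]
  have e : 7 / 11 * ((11 + 165 * s + 462 * s ^ 2 + 330 * s ^ 3 + 55 * s ^ 4 + s ^ 5) /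
        (7 + 35 * s + 21 * s ^ 2 + s ^ 3)) + (1 + 6 * s + s ^ 2) / 4000 -
      (1 + 6 * s + s ^ 2) * (∑ n ∈ Finset.range 6,
        sqrtCoeff n ^ 2 * (16 * s * (1 + s) ^ 2 / (1 + 6 * s + s ^ 2) ^ 2) ^ n +
        sqrtCoeff 6 ^ 2 * (16 * s * (1 + s) ^ 2 / (1 + 6 * s + s ^ 2) ^ 2) ^ 6 /
          ((1 - s) ^ 4 / (1 + 6 * s + s ^ 2) ^ 2)) =
      (77 + 4697 * s + 129283 * s ^ 2 + 1761199 * s ^ 3 + 8951734 * s ^ 4 - 54559874 * s ^ 5 -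
          1006367134 * s ^ 6 - 18471934198 * s ^ 7 - 217140933137 * s ^ 8 -
          1296013869037 * s ^ 9 - 4214910036695 * s ^ 10 - 8427424056435 * s ^ 11 -
          13345433570524 * s ^ 12 - 18213202745388 * s ^ 13 - 14856109644468 * s ^ 14 -
          11425085975620 * s ^ 15 - 6401892926885 * s ^ 16 - 2282706843921 * s ^ 17 -
          580013434587 * s ^ 18 - 106968991527 * s ^ 19 - 4077953594 * s ^ 20 +
          4005015246 * s ^ 21 + 516028210 * s ^ 22 - 209076326 * s ^ 23 - 73400631 * s ^ 24 -
          9747323 * s ^ 25 - 623153 * s ^ 26 - 15989 * s ^ 27) /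
        (44000 * (7 + 35 * s + 21 * s ^ 2 + s ^ 3) * (1 + 6 * s + s ^ 2) ^ 9 * (1 - s) ^ 4) := by
    simp only [Finset.sum_range_succ, Finset.sum_range_zero, sqrtCoeff_succ, sqrtCoeff_zero]
    norm_num
    field_simp
    ring
  have hr : 0 ≤ 4005015246 * s ^ 21 + 516028210 * s ^ 22 := by positivity
  rw [e]
  refine div_pos ?_ (by positivity)
  linarith

lemma hasSum_ellipticE {r x : ℝ} (hx : 0 < x) (hx1 : x ≤ 1) (hr : r ^ 2 = 1 - x ^ 2) :
    HasSum (fun n => (1 + x) / 2 * (sqrtCoeff n ^ 2 * (((1 - x) / (1 + x)) ^ 2) ^ n))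
      (2 / π * ellipticE r) := by
  have hl1 : (1 - x) / (1 + x) < 1 := by rw [div_lt_one (by linarith)]; linarith
  have h := (hasSum_integral_sqrt_cos (div_nonneg (by linarith) (by linarith)) hl1).mul_left
    (2 / π * ((1 + x) / 2))
  have e : 2 / π * ellipticE r = 2 / π * ((1 + x) / 2) * ∫ t in (0:ℝ)..(π / 2),
      √(1 + ((1 - x) / (1 + x)) ^ 2 + 2 * ((1 - x) / (1 + x)) * cos (2 * t)) := by
    rw [mul_assoc, ← intervalIntegral.integral_const_mul, ellipticE]
    congr 2
    ext t
    rw [← sqrt_sq (show 0 ≤ (1 + x) / 2 by linarith), ← sqrt_mul (sq_nonneg _), hr, cos_two_mul,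
      cos_sq']
    congr 1
    field_simp
    ring
  rw [e]
  refine h.congr_fun fun n => ?_
  field_simp

lemma partial_sum_le_ellipticE {r x : ℝ} (hx : 0 < x) (hx1 : x ≤ 1) (hr : r ^ 2 = 1 - x ^ 2)
    (N : ℕ) :
    (1 + x) / 2 * ∑ n ∈ Finset.range N, sqrtCoeff n ^ 2 * (((1 - x) / (1 + x)) ^ 2) ^ n ≤
      2 / π * ellipticE r := by
  rw [Finset.mul_sum]
  exact sum_le_hasSum _ (fun n _ => by positivity) (hasSum_ellipticE hx hx1 hr)

lemma ellipticE_le_partial_sum_add {r x : ℝ} (hx : 0 < x) (hx1 : x ≤ 1) (hr : r ^ 2 = 1 - x ^ 2)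
    (N : ℕ) :
    2 / π * ellipticE r ≤ (1 + x) / 2 *
      (∑ n ∈ Finset.range N, sqrtCoeff n ^ 2 * (((1 - x) / (1 + x)) ^ 2) ^ n +
        sqrtCoeff N ^ 2 * (((1 - x) / (1 + x)) ^ 2) ^ N / (1 - ((1 - x) / (1 + x)) ^ 2)) := by
  have h := hasSum_ellipticE hx hx1 hr
  have hq0 : 0 ≤ ((1 - x) / (1 + x)) ^ 2 := sq_nonneg _
  have hq1 : ((1 - x) / (1 + x)) ^ 2 < 1 := by
    rw [div_pow, div_lt_one (by positivity)]; nlinarith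
  set q := ((1 - x) / (1 + x)) ^ 2
  have hg := (hasSum_geometric_of_lt_one hq0 hq1).mul_left ((1 + x) / 2 * (sqrtCoeff N ^ 2 * q ^ N))
  have ht := (hasSum_nat_add_iff' N).2 h
  have hle := hasSum_le (fun n => ?_) ht hg
  · rw [← Finset.mul_sum] at hle
    have e : (1 + x) / 2 * (sqrtCoeff N ^ 2 * q ^ N / (1 - q)) =
        (1 + x) / 2 * (sqrtCoeff N ^ 2 * q ^ N) * (1 - q)⁻¹ := by ring
    rw [mul_add, e]
    linarith
  · have := antitone_sq_sqrtCoeff (Nat.le_add_left N n)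
    simp only at this
    calc _ ≤ (1 + x) / 2 * (sqrtCoeff N ^ 2 * q ^ (n + N)) := by gcongr
      _ = _ := by ring

lemma S117_eq {y : ℝ} (hy : 0 ≤ y) : S117 (y ^ 4) = 7 / 11 * (1 - y ^ 11) / (1 - y ^ 7) := by
  have h (n : ℕ) : (y ^ 4) ^ ((n : ℝ) / 4) = y ^ n := by
    rw [← rpow_natCast, ← rpow_mul hy, ← rpow_natCast]
    congr 1
    push_cast
    ring
  have h11 := h 11
  have h7 := h 7
  norm_num at h11 h7
  rw [S117, h11, h7]

/-- The substitution `y = (1 - w) / (1 + w)` turns everything into functions of `w ^ 2`. -/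
lemma S117_eq_of_moebius {w : ℝ} (hw : 0 < w) (hw1 : w < 1) :
    S117 (((1 - w) / (1 + w)) ^ 4) = 7 / 11 *
      ((11 + 165 * w ^ 2 + 462 * (w ^ 2) ^ 2 + 330 * (w ^ 2) ^ 3 + 55 * (w ^ 2) ^ 4 +
        (w ^ 2) ^ 5) / (7 + 35 * w ^ 2 + 21 * (w ^ 2) ^ 2 + (w ^ 2) ^ 3)) / (1 + w) ^ 4 := by
  have h1 : 0 < 1 - w := by linarith
  rw [S117_eq (by positivity)]
  have e7 : 1 - ((1 - w) / (1 + w)) ^ 7 =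
      2 * w * (7 + 35 * w ^ 2 + 21 * (w ^ 2) ^ 2 + (w ^ 2) ^ 3) / (1 + w) ^ 7 := by
    field_simp
    ring
  have e11 : 1 - ((1 - w) / (1 + w)) ^ 11 =
      2 * w * (11 + 165 * w ^ 2 + 462 * (w ^ 2) ^ 2 + 330 * (w ^ 2) ^ 3 + 55 * (w ^ 2) ^ 4 +
        (w ^ 2) ^ 5) / (1 + w) ^ 11 := by
    field_simp
    ring
  rw [e7, e11]
  field_simp

lemma one_add_moebius_pow_four {w : ℝ} (hw : 0 < w) :
    (1 + ((1 - w) / (1 + w)) ^ 4) / 2 = (1 + 6 * w ^ 2 + (w ^ 2) ^ 2) / (1 + w) ^ 4 := by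
  field_simp
  ring

lemma landen_moebius_pow_four {w : ℝ} (hw : 0 < w) :
    ((1 - ((1 - w) / (1 + w)) ^ 4) / (1 + ((1 - w) / (1 + w)) ^ 4)) ^ 2 =
      16 * w ^ 2 * (1 + w ^ 2) ^ 2 / (1 + 6 * w ^ 2 + (w ^ 2) ^ 2) ^ 2 := by
  have h : 1 + ((1 - w) / (1 + w)) ^ 4 = 2 * (1 + 6 * w ^ 2 + (w ^ 2) ^ 2) / (1 + w) ^ 4 := by
    field_simp
    ring
  rw [h]
  field_simp
  ring

lemma S117_lt_ellipticE_of_moebius {w r : ℝ} (hw : 0 < w) (hw1 : w ^ 2 ≤ 27 / 100)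
    (hr : r ^ 2 = 1 - (((1 - w) / (1 + w)) ^ 4) ^ 2) :
    S117 (((1 - w) / (1 + w)) ^ 4) < 2 / π * ellipticE r := by
  have h1 : 0 < 1 - w := by nlinarith
  have hx1 : ((1 - w) / (1 + w)) ^ 4 ≤ 1 :=
    pow_le_one₀ (by positivity) (by rw [div_le_one (by linarith)]; linarith)
  refine lt_of_lt_of_le ?_ (partial_sum_le_ellipticE (by positivity) hx1 hr 8)
  rw [S117_eq_of_moebius hw (by linarith), one_add_moebius_pow_four hw, landen_moebius_pow_four hw,
    div_mul_eq_mul_div (1 + 6 * w ^ 2 + (w ^ 2) ^ 2)]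
  exact div_lt_div_of_pos_right (stolarsky_lt_partial_sum (by positivity) hw1) (by positivity)

lemma two_div_pi_gt : 7 / 11 + 1 / 4000 < 2 / π := by
  rw [lt_div_iff₀ pi_pos]
  linarith [pi_lt_d4]

lemma ellipticE_lt_S117_add_of_moebius {w r : ℝ} (hw : 0 < w) (hw1 : w ^ 2 ≤ 9 / 100)
    (hr : r ^ 2 = 1 - (((1 - w) / (1 + w)) ^ 4) ^ 2) :
    2 / π * ellipticE r < S117 (((1 - w) / (1 + w)) ^ 4) + (2 / π - 7 / 11) := by
  have h1 : 0 < 1 - w := by nlinarith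
  have hx1 : ((1 - w) / (1 + w)) ^ 4 ≤ 1 :=
    pow_le_one₀ (by positivity) (by rw [div_le_one (by linarith)]; linarith)
  refine (ellipticE_le_partial_sum_add (by positivity) hx1 hr 6).trans_lt ?_
  rw [S117_eq_of_moebius hw (by linarith), one_add_moebius_pow_four hw, landen_moebius_pow_four hw,
    div_mul_eq_mul_div, div_lt_iff₀ (by positivity),
    add_mul (_ / _), div_mul_cancel₀ _ (by positivity)]
  refine (partial_sum_lt_stolarsky_add (by positivity) hw1).trans_le (add_le_add_right ?_ _)
  have hT : 1 + 6 * w ^ 2 + (w ^ 2) ^ 2 ≤ (1 + w) ^ 4 := by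
    have : 0 ≤ w * (1 + w ^ 2) := by positivity
    linarith [show (1 + w) ^ 4 = 1 + 6 * w ^ 2 + (w ^ 2) ^ 2 + 4 * (w * (1 + w ^ 2)) by ring]
  have := two_div_pi_gt
  nlinarith

lemma two_div_pi_le_ellipticE {r : ℝ} (hr : r ^ 2 ≤ 1) : 2 / π ≤ 2 / π * ellipticE r := by
  refine le_mul_of_one_le_right (by positivity) ?_
  have h : ∫ t in (0:ℝ)..(π / 2), cos t = 1 := by simp
  rw [← h, ellipticE]
  refine intervalIntegral.integral_mono_on (by positivity)
    (Continuous.intervalIntegrable (by fun_prop) _ _)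
    (Continuous.intervalIntegrable (by fun_prop) _ _) fun t _ => le_sqrt_of_sq_le ?_
  rw [cos_sq']
  nlinarith [sq_nonneg (sin t)]

lemma S117_lt_two_div_pi {y : ℝ} (hy : 0 < y) (hy1 : y ≤ 8 / 25) : S117 (y ^ 4) < 2 / π := by
  refine lt_trans ?_ two_div_pi_gt
  have h7 : y ^ 7 ≤ (8 / 25) ^ 7 := by gcongr
  have h : 0 < 1 - y ^ 7 := by norm_num at h7; linarith
  have h4 : 0 ≤ y ^ 7 * (y ^ 4 - y ^ 7) := by
    have : y ^ 7 ≤ y ^ 4 := pow_le_pow_of_le_one hy.le (by linarith) (by norm_num)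
    exact mul_nonneg (by positivity) (by linarith)
  rw [S117_eq hy.le, div_lt_iff₀ h]
  norm_num at h7
  have : y ^ 7 * y ^ 4 = y ^ 11 := by ring
  have : y ^ 7 * y ^ 7 ≤ y ^ 7 * (1 / 100) := by gcongr; linarith
  nlinarith

lemma sqrt_one_sub_le {v : ℝ} (hv : 0 ≤ v) (hv1 : v ≤ 1) :
    √(1 - v) ≤ 1 - v / 2 - v ^ 2 / 8 - v ^ 3 / 16 := by
  rw [sqrt_le_iff]
  constructor
  · nlinarith [pow_le_one₀ hv hv1 (n := 2), pow_le_one₀ hv hv1 (n := 3)]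
  · have : 0 ≤ 5 / 64 * v ^ 4 + v ^ 5 / 64 + v ^ 6 / 256 := by positivity
    linarith [show (1 - v / 2 - v ^ 2 / 8 - v ^ 3 / 16) ^ 2 =
      1 - v + (5 / 64 * v ^ 4 + v ^ 5 / 64 + v ^ 6 / 256) by ring]

lemma le_sqrt_sub_mul_sq {x u : ℝ} (hx : 0 < x) (hu : 0 ≤ u) :
    x ^ 2 / 2 * (u - 9 / 25 * x) ≤ (√(u ^ 2 + x ^ 2) - u) * u ^ 2 := by
  obtain ⟨d, hd⟩ : ∃ d, d = √(u ^ 2 + x ^ 2) - u := ⟨_, rfl⟩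
  have hd0 : 0 ≤ d := by
    rw [hd, sub_nonneg]
    exact le_sqrt_of_sq_le (by nlinarith)
  have hxd : x ^ 2 = d * (d + 2 * u) := by
    have := sq_sqrt (show 0 ≤ u ^ 2 + x ^ 2 by positivity)
    rw [show √(u ^ 2 + x ^ 2) = d + u by rw [hd]; ring] at this
    linarith [show (d + u) ^ 2 = d * (d + 2 * u) + u ^ 2 by ring]
  have key : 25 / 9 * (d * u) ≤ x * (d + 2 * u) := by
    rw [← sq_le_sq₀ (by positivity) (by positivity), mul_pow x, hxd]
    have : 0 ≤ d ^ 4 + 6 * d ^ 3 * u + (12 - 625 / 81) * (d ^ 2 * u ^ 2) + 8 * d * u ^ 3 := by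
      positivity
    linarith [show d * (d + 2 * u) * (d + 2 * u) ^ 2 - (25 / 9 * (d * u)) ^ 2 =
      d ^ 4 + 6 * d ^ 3 * u + (12 - 625 / 81) * (d ^ 2 * u ^ 2) + 8 * d * u ^ 3 by ring]
  rw [← hd]
  have := mul_le_mul_of_nonneg_left key hd0
  linarith [show x ^ 2 / 2 * (u - 9 / 25 * x) = d * u ^ 2 + d * (d * u) / 2 -
    9 / 50 * (d * (x * (d + 2 * u))) by rw [hxd]; ring]

/-- An upper bound for `√(1 - u ^ 2) * (√(u ^ 2 + x ^ 2) - u)` with an elementary primitive. -/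
noncomputable def majorant (x u : ℝ) : ℝ :=
  √(u ^ 2 + x ^ 2) - u - x ^ 2 / 2 * (u / 2 + u ^ 3 / 8 + u ^ 5 / 16 -
    9 / 25 * x * (1 / 2 + u ^ 2 / 8 + u ^ 4 / 16))

/-- A primitive of `majorant x`. -/
noncomputable def majorantPrimitive (x u : ℝ) : ℝ :=
  1 / 2 * (u * √(u ^ 2 + x ^ 2) + x ^ 2 * log (u + √(u ^ 2 + x ^ 2))) - u ^ 2 / 2 -
    x ^ 2 / 2 * (u ^ 2 / 4 + u ^ 4 / 32 + u ^ 6 / 96 -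
      9 / 25 * x * (u / 2 + u ^ 3 / 24 + u ^ 5 / 80))

lemma sqrt_mul_sqrt_sub_le_majorant {x u : ℝ} (hx : 0 < x) (hu : 0 ≤ u) (hu1 : u ≤ 1) :
    √(1 - u ^ 2) * (√(u ^ 2 + x ^ 2) - u) ≤ majorant x u := by
  have h1 := sqrt_one_sub_le (sq_nonneg u) (pow_le_one₀ hu hu1)
  have hd : 0 ≤ √(u ^ 2 + x ^ 2) - u := by
    rw [sub_nonneg]
    exact le_sqrt_of_sq_le (by nlinarith)
  have h2 := le_sqrt_sub_mul_sq hx hu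
  have h3 := mul_le_mul_of_nonneg_right h2 (show 0 ≤ 1 / 2 + u ^ 2 / 8 + u ^ 4 / 16 by positivity)
  refine (mul_le_mul_of_nonneg_right h1 hd).trans ?_
  rw [majorant]
  linarith

lemma hasDerivAt_majorantPrimitive {x : ℝ} (hx : 0 < x) {u : ℝ} (hu : 0 ≤ u) :
    HasDerivAt (majorantPrimitive x) (majorant x u) u := by
  have hp : 0 < u ^ 2 + x ^ 2 := by positivity
  have hR := sqrt_pos.2 hp
  have hs : HasDerivAt (fun v : ℝ => √(v ^ 2 + x ^ 2)) (u / √(u ^ 2 + x ^ 2)) u :=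
    (((hasDerivAt_pow 2 u).add_const (x ^ 2)).sqrt hp.ne').congr_deriv (by
      field_simp
      norm_num)
  have hl : HasDerivAt (fun v : ℝ => log (v + √(v ^ 2 + x ^ 2))) (1 / √(u ^ 2 + x ^ 2)) u :=
    (((hasDerivAt_id' u).fun_add hs).log (by positivity)).congr_deriv (by
      field_simp
      ring)
  have hm : HasDerivAt (fun v : ℝ => v * √(v ^ 2 + x ^ 2))
      (√(u ^ 2 + x ^ 2) + u * (u / √(u ^ 2 + x ^ 2))) u :=
    ((hasDerivAt_id' u).fun_mul hs).congr_deriv (by ring)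
  have hpw (n : ℕ) := hasDerivAt_pow n u
  have hpoly := ((hpw 2).div_const 2).fun_add ((((((hpw 2).div_const 4).fun_add
    ((hpw 4).div_const 32)).fun_add ((hpw 6).div_const 96)).fun_sub
    (((((hpw 1).div_const 2).fun_add ((hpw 3).div_const 24)).fun_add
    ((hpw 5).div_const 80)).const_mul (9 / 25 * x))).const_mul (x ^ 2 / 2))
  have h := ((hm.fun_add (hl.const_mul (x ^ 2))).const_mul (1 / 2)).fun_sub hpoly
  have e : 1 / 2 * (√(u ^ 2 + x ^ 2) + u * (u / √(u ^ 2 + x ^ 2)) +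
      x ^ 2 * (1 / √(u ^ 2 + x ^ 2))) = √(u ^ 2 + x ^ 2) := by
    have := sq_sqrt hp.le
    field_simp
    linarith
  rw [e] at h
  refine (h.congr_deriv ?_).congr_of_eventuallyEq (.of_forall fun v => ?_)
  · rw [majorant]
    norm_num
    ring
  · simp only [majorantPrimitive]
    ring

lemma majorantPrimitive_sub_le {x : ℝ} (hx : 0 < x) :
    majorantPrimitive x 1 - majorantPrimitive x 0 ≤
      x ^ 2 / 2 * (5 / 24 + log 2 + x ^ 2 / 4 + x / 5 - log x) := by
  have h1 : √(1 + x ^ 2) ≤ 1 + x ^ 2 / 2 := sqrt_one_add_le (by nlinarith)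
  have h2 : log (1 + √(1 + x ^ 2)) ≤ log 2 + x ^ 2 / 4 := by
    calc log (1 + √(1 + x ^ 2)) ≤ log (2 * (1 + x ^ 2 / 4)) :=
          log_le_log (by positivity) (by linarith)
      _ = log 2 + log (1 + x ^ 2 / 4) := log_mul (by norm_num) (by positivity)
      _ ≤ log 2 + x ^ 2 / 4 := by
          have := log_le_sub_one_of_pos (show 0 < 1 + x ^ 2 / 4 by positivity)
          linarith
  have h3 := mul_le_mul_of_nonneg_left h2 (sq_nonneg x)
  have hx3 : 0 < x ^ 2 * x := by positivity
  simp only [majorantPrimitive]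
  norm_num [sqrt_sq hx.le]
  nlinarith

lemma sqrt_sub_cos_le {r x t : ℝ} (hx : 0 < x) (hr0 : 0 < r) (hr : r ^ 2 = 1 - x ^ 2)
    (ht : t ∈ Set.Icc 0 (π / 2)) :
    √(1 - r ^ 2 * sin t ^ 2) ≤ cos t + 1 / r * (sin t * majorant x (cos t)) := by
  have hc : 0 ≤ cos t := cos_nonneg_of_mem_Icc ⟨by linarith [ht.1, pi_pos], ht.2⟩
  have hs : 0 ≤ sin t := sin_nonneg_of_mem_Icc ⟨ht.1, by linarith [ht.2, pi_pos]⟩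
  have hm := sqrt_mul_sqrt_sub_le_majorant hx hc (cos_le_one t)
  rw [← sin_sq, sqrt_sq hs] at hm
  have hA2 : 1 - r ^ 2 * sin t ^ 2 = cos t ^ 2 + x ^ 2 * sin t ^ 2 := by
    rw [hr, cos_sq']; ring
  have hR2 := sq_sqrt (show 0 ≤ cos t ^ 2 + x ^ 2 by positivity)
  have hRc : cos t ≤ √(cos t ^ 2 + x ^ 2) := le_sqrt_of_sq_le (by nlinarith)
  set R := √(cos t ^ 2 + x ^ 2)
  have hr1 : r ≤ 1 := by nlinarith
  have h := mul_le_mul_of_nonneg_left (mul_le_mul_of_nonneg_left hm hs) (one_div_pos.2 hr0).le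
  refine le_trans ?_ (add_le_add_right h _)
  set A := √(1 - r ^ 2 * sin t ^ 2)
  have hA : A ^ 2 = cos t ^ 2 + x ^ 2 * sin t ^ 2 := by
    rw [← hA2]
    exact sq_sqrt (by rw [hA2]; positivity)
  have hA0 : 0 ≤ A := sqrt_nonneg _
  have hsc := sin_sq_add_cos_sq t
  have hrA : r * R ≤ A := by
    rw [← sq_le_sq₀ (by positivity) hA0, mul_pow, hR2, hA, hr, sin_sq]
    nlinarith [sq_nonneg (x ^ 2)]
  have hRpos : 0 < R + cos t := by
    have : 0 < R := sqrt_pos.2 (by positivity)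
    linarith
  have hAc : 0 ≤ A - cos t := by
    rw [sub_nonneg, ← sq_le_sq₀ hc hA0, hA]
    nlinarith [sq_nonneg (x * sin t)]
  have hprod : (A - cos t) * (r * (R + cos t)) ≤ sin t ^ 2 * (R - cos t) * (R + cos t) := by
    calc (A - cos t) * (r * (R + cos t)) ≤ (A - cos t) * (A + cos t) :=
          mul_le_mul_of_nonneg_left (by nlinarith) hAc
      _ = sin t ^ 2 * (R - cos t) * (R + cos t) := by linear_combination hA - sin t ^ 2 * hR2
  have hle : (A - cos t) * r ≤ sin t ^ 2 * (R - cos t) :=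
    le_of_mul_le_mul_right (by linarith) hRpos
  rw [← sub_le_iff_le_add', one_div_mul_eq_div, le_div_iff₀ hr0]
  linarith

lemma integral_sin_mul_majorant {x : ℝ} (hx : 0 < x) :
    ∫ t in (0:ℝ)..(π / 2), sin t * majorant x (cos t) =
      majorantPrimitive x 1 - majorantPrimitive x 0 := by
  have hd (t : ℝ) (ht : t ∈ Set.uIcc 0 (π / 2)) :
      HasDerivAt (fun t => -majorantPrimitive x (cos t)) (sin t * majorant x (cos t)) t := by
    rw [Set.uIcc_of_le (by positivity)] at ht
    have hc : 0 ≤ cos t := cos_nonneg_of_mem_Icc ⟨by linarith [ht.1, pi_pos], ht.2⟩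
    exact (((hasDerivAt_majorantPrimitive hx hc).comp t (hasDerivAt_cos t)).fun_neg).congr_deriv
      (by ring)
  rw [intervalIntegral.integral_eq_sub_of_hasDerivAt hd
    (Continuous.intervalIntegrable (by unfold majorant; fun_prop) _ _)]
  simp
  ring

lemma ellipticE_le_log {r x : ℝ} (hx : 0 < x) (hr0 : 0 < r) (hr : r ^ 2 = 1 - x ^ 2) :
    2 / π * ellipticE r ≤
      2 / π + x ^ 2 / (π * r) * (5 / 24 + log 2 + x ^ 2 / 4 + x / 5 - log x) := by
  have hcont : Continuous fun t => sin t * majorant x (cos t) := by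
    unfold majorant
    fun_prop
  have h : ellipticE r ≤ 1 + 1 / r * (majorantPrimitive x 1 - majorantPrimitive x 0) := by
    have e : ∫ t in (0:ℝ)..(π / 2), (cos t + 1 / r * (sin t * majorant x (cos t))) =
        1 + 1 / r * (majorantPrimitive x 1 - majorantPrimitive x 0) := by
      rw [intervalIntegral.integral_add (continuous_cos.intervalIntegrable _ _)
        ((hcont.const_mul _).intervalIntegrable _ _), intervalIntegral.integral_const_mul,
        integral_sin_mul_majorant hx]
      simp
    rw [← e, ellipticE]
    exact intervalIntegral.integral_mono_on (by positivity)
      (Continuous.intervalIntegrable (by fun_prop) _ _)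
      (Continuous.intervalIntegrable (continuous_cos.add (hcont.const_mul _)) _ _)
      fun t ht => sqrt_sub_cos_le hx hr0 hr ht
  calc 2 / π * ellipticE r ≤ 2 / π * (1 + 1 / r *
        (x ^ 2 / 2 * (5 / 24 + log 2 + x ^ 2 / 4 + x / 5 - log x))) := by
        have := majorantPrimitive_sub_le hx
        gcongr
        exact h.trans (by gcongr)
    _ = _ := by
        field_simp

lemma neg_mul_log_le {a y : ℝ} (ha : 0 < a) (hy : 0 < y) :
    -(y * log y) ≤ y * log a + 1 / a - y := by
  have h := log_le_sub_one_of_pos (show 0 < 1 / (a * y) by positivity)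
  rw [one_div, log_inv, log_mul ha.ne' hy.ne'] at h
  have h' := mul_le_mul_of_nonneg_left h hy.le
  have e : y * ((a * y)⁻¹ - 1) = 1 / a - y := by field_simp
  linarith

lemma mul_log_bound_lt {y : ℝ} (hy : 0 < y) (hy1 : y ≤ 7 / 13) :
    11 * (1 - y ^ 7) * (y * (5 / 24 + log 2 + (y ^ 4) ^ 2 / 4 + y ^ 4 / 5 - log (y ^ 4))) <
      7 * π * ((1 - y ^ 4) * (1 - y ^ 8)) := by
  have hpi := pi_gt_d4
  have hlog2 := log_two_lt_d9
  have hlog4 : log (y ^ 4) = 4 * log y := by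
    rw [log_pow]
    norm_num
  have h4 : y ^ 4 ≤ (7 / 13) ^ 4 := by gcongr
  have h7 : y ^ 7 ≤ (7 / 13) ^ 7 := by gcongr
  have h8 : y ^ 8 ≤ (7 / 13) ^ 8 := by gcongr
  norm_num at h4 h7 h8
  have hy7 : 0 < 11 * (1 - y ^ 7) := by linarith
  have hpos : 0 < (1 - y ^ 4) * (1 - y ^ 8) := mul_pos (by linarith) (by linarith)
  rw [hlog4]
  refine lt_trans ?_ (mul_lt_mul_of_pos_right (mul_lt_mul_of_pos_left hpi (by norm_num)) hpos)
  have hyl := mul_le_mul_of_nonneg_left hlog2.le hy.le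
  rcases le_total y (1 / 4) with h | h
  · have hl := neg_mul_log_le (show (0:ℝ) < 2 ^ 2 by norm_num) hy
    rw [log_pow] at hl
    have h4 : y ^ 4 ≤ (1 / 4) ^ 4 := by gcongr
    have h8 : y ^ 8 ≤ (1 / 4) ^ 8 := by gcongr
    norm_num at h4 h8 hl
    have hb : y * (5 / 24 + log 2 + (y ^ 4) ^ 2 / 4 + y ^ 4 / 5 - 4 * log y) ≤ 1.62 := by
      have : y * y ^ 4 ≤ 1 / 4 * (1 / 256) := by gcongr
      have : y * y ^ 8 ≤ 1 / 4 * (1 / 65536) := by gcongr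
      nlinarith
    calc _ ≤ 11 * (1 - y ^ 7) * 1.62 := by gcongr
      _ ≤ 11 * 1.62 := by nlinarith [pow_pos hy 7]
      _ < _ := by nlinarith [pow_pos hy 12]
  · have hl := neg_mul_log_le two_pos hy
    have hb : y * (5 / 24 + log 2 + (y ^ 4) ^ 2 / 4 + y ^ 4 / 5 - 4 * log y) ≤
        2 - 0.3257 * y + y ^ 5 / 5 + y ^ 9 / 4 := by
      linarith [show y * (y ^ 4) ^ 2 = y ^ 9 by ring, show y * y ^ 4 = y ^ 5 by ring]
    refine (mul_le_mul_of_nonneg_left hb hy7.le).trans_lt ?_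
    have h3 : y ^ 3 ≤ (7 / 13) ^ 3 := by gcongr
    have h6 : y ^ 6 ≤ (7 / 13) ^ 6 := by gcongr
    have hz : y ^ 3 * (1 - y ^ 3) ≤ (7 / 13) ^ 3 * (1 - (7 / 13) ^ 3) := by
      norm_num at h3 ⊢
      nlinarith
    norm_num at h3 h6 hz
    have key : 0 < y * (3.5447 - 22 * (y ^ 3 * (1 - y ^ 3)) - 2.2 * y ^ 4 - 25.58 * y ^ 7 -
        2.75 * y ^ 8) := mul_pos hy (by linarith)
    nlinarith only [key, h, pow_pos hy 4, pow_pos hy 7, pow_pos hy 8, pow_pos hy 12,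
      pow_pos hy 16]

lemma ellipticE_lt_S117_add_of_le {y r : ℝ} (hy : 0 < y) (hy1 : y ≤ 7 / 13) (hr0 : 0 < r)
    (hr : r ^ 2 = 1 - (y ^ 4) ^ 2) :
    2 / π * ellipticE r < S117 (y ^ 4) + (2 / π - 7 / 11) := by
  have h := mul_log_bound_lt hy hy1
  refine (ellipticE_le_log (by positivity) hr0 hr).trans_lt ?_
  set B := 5 / 24 + log 2 + (y ^ 4) ^ 2 / 4 + y ^ 4 / 5 - log (y ^ 4)
  have hy7 : 0 < 1 - y ^ 7 := sub_pos.2 (pow_lt_one₀ hy.le (by linarith) (by norm_num))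
  have hy4 : 0 < 1 - y ^ 4 := sub_pos.2 (pow_lt_one₀ hy.le (by linarith) (by norm_num))
  have hyr : 1 - y ^ 8 ≤ r := by
    have : 0 < y ^ 8 := by positivity
    nlinarith [show (y ^ 4) ^ 2 = y ^ 8 by ring]
  have e : S117 (y ^ 4) = 7 / 11 + y ^ 7 * (7 * (1 - y ^ 4) / (11 * (1 - y ^ 7))) := by
    rw [S117_eq hy.le]
    field_simp
    ring
  have hB : y * B / (π * r) < 7 * (1 - y ^ 4) / (11 * (1 - y ^ 7)) := by
    rw [div_lt_div_iff₀ (by positivity) (by positivity)]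
    calc y * B * (11 * (1 - y ^ 7)) < 7 * π * ((1 - y ^ 4) * (1 - y ^ 8)) := by linarith
      _ ≤ 7 * π * ((1 - y ^ 4) * r) := by gcongr
      _ = _ := by ring
  have := mul_lt_mul_of_pos_left hB (pow_pos hy 7)
  rw [e]
  linarith [show (y ^ 4) ^ 2 / (π * r) * B = y ^ 7 * (y * B / (π * r)) by ring]

theorem ellipticE_sub_S117_bounds (r : ℝ) (hr : r ∈ Set.Ioo (0:ℝ) 1) :
    0 < 2 / π * ellipticE r - S117 (Real.sqrt (1 - r ^ 2)) ∧
    2 / π * ellipticE r - S117 (Real.sqrt (1 - r ^ 2)) < 2 / π - 7 / 11 := by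
  obtain ⟨hr0, hr1⟩ := hr
  have hp : 0 < 1 - r ^ 2 := by nlinarith
  obtain ⟨y, hy0, hy⟩ : ∃ y : ℝ, 0 < y ∧ y ^ 4 = √(1 - r ^ 2) :=
    ⟨√(√(√(1 - r ^ 2))), by positivity, by
      rw [show 4 = 2 * 2 from rfl, pow_mul, sq_sqrt (sqrt_nonneg _), sq_sqrt (sqrt_nonneg _)]⟩
  have hry : r ^ 2 = 1 - (y ^ 4) ^ 2 := by
    rw [hy, sq_sqrt hp.le]
    ring
  have hy1 : y < 1 := by
    by_contra! h
    nlinarith [one_le_pow₀ h (n := 8)]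
  rw [← hy, sub_pos, sub_lt_iff_lt_add']
  obtain ⟨w, hw⟩ : ∃ w, w = (1 - y) / (1 + y) := ⟨_, rfl⟩
  have hw0 : 0 < w := hw ▸ div_pos (by linarith) (by linarith)
  have hyw : y = (1 - w) / (1 + w) := by
    rw [hw]
    field_simp
    ring
  constructor
  · rcases le_total y (8 / 25) with h | h
    · exact (S117_lt_two_div_pi hy0 h).trans_le (two_div_pi_le_ellipticE (by linarith))
    · have hw1 : w ≤ 17 / 33 := by
        rw [hw, div_le_iff₀ (by linarith)]
        linarith
      rw [hyw] at hry ⊢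
      exact S117_lt_ellipticE_of_moebius hw0 (by nlinarith) hry
  · rcases le_total y (7 / 13) with h | h
    · exact ellipticE_lt_S117_add_of_le hy0 h hr0 hry
    · have hw1 : w ≤ 3 / 10 := by
        rw [hw, div_le_iff₀ (by linarith)]
        linarith
      rw [hyw] at hry ⊢
      exact ellipticE_lt_S117_add_of_moebius hw0 (by nlinarith) hry
end
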